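/- Let z ∈ ℂ \ [0,∞). Then on [x₁(z),∞) the function a(·,z) is continuously differentiable with ∂a/∂x(x,z) = −ω(x,z)a(x,z), the function p·∂a/∂x(·,z) is locally absolutely continuous on [x₁(z),∞), the remainder r(x,z) := −a(x,z)⁻¹(p(x)·∂a/∂x(x,z))' + q(x) − z satisfies r(x,z) = (p(x)ω(x,z))' for almost every x ≥ x₁(z), and r(·,z) is integrable on (x₁(z),∞). -/

import Mathlib

open MeasureTheory Filter Set Complex

noncomputable section

/-- The principal-branch square root `ω(x,z) = ((q x − z)/p x)^{1/2}`. -/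
def omg (p q : ℝ → ℝ) (z : ℂ) (x : ℝ) : ℂ :=
  (((q x : ℂ) - z) / (p x : ℂ)) ^ (1 / 2 : ℂ)

/-- `Ω(x,z) = ∫₀ˣ ω(y,z) dy`. -/
def Omg (p q : ℝ → ℝ) (z : ℂ) (x : ℝ) : ℂ :=
  ∫ y in (0:ℝ)..x, omg p q z y

/-- `a(x,z) = exp(−Ω(x,z))`. -/
def aa (p q : ℝ → ℝ) (z : ℂ) (x : ℝ) : ℂ :=
  Complex.exp (-(Omg p q z x))

/-- Assumption (PQ): `p > 0` on `[0,∞)`, locally absolutely continuous with integrable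
derivative `p'` and limit `p₀ > 0` at `+∞`; `q` integrable on `(0,x₀)`, locally absolutely
continuous on `[x₀,∞)` with integrable derivative `q'` there, and `q → 0` at `+∞`.
Absolute continuity is encoded by the fundamental theorem of calculus representation. -/
structure PQData (p p' q q' : ℝ → ℝ) (p₀ x₀ : ℝ) : Prop where
  p_pos : ∀ x : ℝ, 0 ≤ x → 0 < p x
  hp₀ : 0 < p₀
  hx₀ : 0 ≤ x₀
  p_ac : ∀ x : ℝ, 0 ≤ x → p x = p 0 + ∫ t in (0:ℝ)..x, p' t
  p'_int : IntegrableOn p' (Ioi (0:ℝ))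
  p_lim : Tendsto p atTop (nhds p₀)
  q_int : IntegrableOn q (Ioo (0:ℝ) x₀)
  q_ac : ∀ x : ℝ, x₀ ≤ x → q x = q x₀ + ∫ t in x₀..x, q' t
  q'_int : IntegrableOn q' (Ioi x₀)
  q_lim : Tendsto q atTop (nhds (0:ℝ))

/-- `f` (with derivative `f'`) solves `−(p f')' + q f = z f` on `I`:
`f` is differentiable on `I` with derivative `f'`, and `p·f'` is locally absolutely
continuous on `I` with a.e. derivative `(q − z)·f` (encoded via the FTC representation). -/
def IsSol (p q : ℝ → ℝ) (z : ℂ) (I : Set ℝ) (f f' : ℝ → ℂ) : Prop :=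
  (∀ x ∈ I, HasDerivWithinAt f (f' x) I x) ∧
    ∀ x ∈ I, ∀ y ∈ I,
      (p y : ℂ) * f' y - (p x : ℂ) * f' x = ∫ t in x..y, ((q t : ℂ) - z) * f t

/-- `ε(x) = ∫ₓ^∞ (|p'| + |q'|)`. -/
def eps (p' q' : ℝ → ℝ) (x : ℝ) : ℝ :=
  ∫ y in Ioi x, (|p' y| + |q' y|)

/-- The Volterra kernel `G(x,y,z) = a(y,z)² ∫ₓ^y p(s)⁻¹ a(s,z)⁻² ds`. -/
def Gker (p q : ℝ → ℝ) (z : ℂ) (x y : ℝ) : ℂ :=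
  aa p q z y ^ 2 * ∫ s in x..y, ((p s : ℂ))⁻¹ * (aa p q z s ^ 2)⁻¹

/-- `Φ(x,λ) = ∫₀ˣ √(max((λ − q)/p, 0))`. -/
def Phi (p q : ℝ → ℝ) (lam x : ℝ) : ℝ :=
  ∫ y in (0:ℝ)..x, Real.sqrt (max ((lam - q y) / p y) 0)

/-- `K(λ) = exp(−∫₀^∞ √(max((q − λ)/p, 0)))`. -/
def Kc (p q : ℝ → ℝ) (lam : ℝ) : ℝ :=
  Real.exp (-∫ y in Ioi (0:ℝ), Real.sqrt (max ((q y - lam) / p y) 0))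

/-- `ξ(x) = θ(x)·∫_ϱ^x θ(y)⁻² p(y)⁻¹ dy`. -/
def xiFun (p : ℝ → ℝ) (θ : ℝ → ℂ) (ϱ x : ℝ) : ℂ :=
  θ x * ∫ y in ϱ..x, (θ y ^ 2)⁻¹ * ((p y : ℂ))⁻¹

/-- The derivative of `ξ`: `ξ'(x) = θ'(x)·∫_ϱ^x θ⁻² p⁻¹ + θ(x)⁻¹ p(x)⁻¹`. -/
def xiFun' (p : ℝ → ℝ) (θ θ' : ℝ → ℂ) (ϱ x : ℝ) : ℂ :=
  θ' x * (∫ y in ϱ..x, (θ y ^ 2)⁻¹ * ((p y : ℂ))⁻¹) + (θ x)⁻¹ * ((p x : ℂ))⁻¹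

open scoped Topology in
lemma ac_of_dist_le {X Y : Type*} [PseudoMetricSpace X] [PseudoMetricSpace Y]
    {f : ℝ → X} {h : ℝ → Y} {a b K : ℝ}
    (hf : AbsolutelyContinuousOnInterval f a b)
    (hK : ∀ u ∈ uIcc a b, ∀ v ∈ uIcc a b, dist (h u) (h v) ≤ K * dist (f u) (f v)) :
    AbsolutelyContinuousOnInterval h a b := by
  unfold AbsolutelyContinuousOnInterval at *
  refine squeeze_zero' (Eventually.of_forall fun E => Finset.sum_nonneg fun i _ => dist_nonneg) ?_
    (by simpa using hf.const_mul K)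
  have hm : AbsolutelyContinuousOnInterval.disjWithin a b ∈
      (AbsolutelyContinuousOnInterval.totalLengthFilter ⊓
        𝓟 (AbsolutelyContinuousOnInterval.disjWithin a b)) :=
    mem_inf_of_right (mem_principal_self _)
  filter_upwards [hm] with E hE
  rw [Finset.mul_sum]
  exact Finset.sum_le_sum fun i hi => hK _ (hE.1 i hi).1 _ (hE.1 i hi).2

lemma ftc_complex {H g : ℝ → ℂ} {a b : ℝ} (hH : AbsolutelyContinuousOnInterval H a b)
    (hd : ∀ᵐ t, t ∈ uIoc a b → HasDerivAt H (g t) t)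
    (hg : IntervalIntegrable g volume a b) :
    H b - H a = ∫ t in a..b, g t := by
  have key : ∀ L : ℂ →L[ℝ] ℝ, L (H b - H a) = L (∫ t in a..b, g t) := by
    intro L
    have h1 : AbsolutelyContinuousOnInterval (fun t => L (H t)) a b := by
      refine ac_of_dist_le (K := ‖L‖) hH ?_
      intro u _ v _
      rw [dist_eq_norm, dist_eq_norm, ← map_sub]
      exact L.le_opNorm _
    rw [← L.intervalIntegral_comp_comm hg, map_sub, ← h1.integral_deriv_eq_sub]
    apply intervalIntegral.integral_congr_ae
    filter_upwards [hd] with t ht htt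
    exact (L.hasFDerivAt.comp_hasDerivAt t (ht htt)).deriv
  apply Complex.ext
  · exact key Complex.reCLM
  · exact key Complex.imCLM

lemma prim_facts {f f' : ℝ → ℝ} {c : ℝ} (h : ∀ x, c ≤ x → f x = f c + ∫ t in c..x, f' t)
    (hi : IntegrableOn f' (Ioi c)) :
    ContinuousOn f (Ici c) ∧ (∀ᵐ x, c < x → HasDerivAt f (f' x) x) ∧
      ∀ x, c ≤ x → ∀ y, c ≤ y → AbsolutelyContinuousOnInterval f x y := by
  have hI : ∀ x, c ≤ x → ∀ y, c ≤ y → IntervalIntegrable f' volume x y := by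
    intro x hx y hy
    rw [intervalIntegrable_iff]
    exact hi.mono_set fun t ht => lt_of_le_of_lt (le_min hx hy) ht.1
  set F := (Ioi c).indicator f' with hF
  have hFi : Integrable F := by
    rwa [hF, integrable_indicator_iff measurableSet_Ioi]
  have hfF : ∀ x, c ≤ x → f x = f c + ∫ t in c..x, F t := by
    intro x hx
    rw [h x hx]
    congr 1
    apply intervalIntegral.integral_congr_ae
    refine Eventually.of_forall fun t ht => ?_
    rw [uIoc_of_le hx] at ht
    exact (indicator_of_mem (show t ∈ Ioi c from ht.1) _).symm
  refine ⟨?_, ?_, ?_⟩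
  · have : Continuous fun x => f c + ∫ t in c..x, F t :=
      continuous_const.add (intervalIntegral.continuous_primitive
        (fun a b => hFi.intervalIntegrable) c)
    exact this.continuousOn.congr fun x hx => hfF x hx
  · filter_upwards [LocallyIntegrable.ae_hasDerivAt_integral hFi.locallyIntegrable] with x hx hcx
    have h1 := (hx c).const_add (f c)
    rw [hF, indicator_of_mem (show x ∈ Ioi c from hcx)] at h1
    refine h1.congr_of_eventuallyEq ?_
    filter_upwards [Ioi_mem_nhds hcx] with y hy
    exact hfF y (le_of_lt hy)
  · intro x hx y hy
    have h1 : AbsolutelyContinuousOnInterval (fun t => ∫ v in c..t, F v) c (max x y) :=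
      (hFi.intervalIntegrable).absolutelyContinuousOnInterval_intervalIntegral (by simp)
    have hsub : uIcc x y ⊆ uIcc c (max x y) := by
      rw [uIcc_of_le (le_trans hx (le_max_left x y))]
      intro t ht
      exact ⟨le_trans (le_min hx hy) ht.1, ht.2⟩
    refine ac_of_dist_le (K := 1) (h1.mono hsub) ?_
    intro u hu v hv
    rw [hfF u (le_trans (le_min hx hy) hu.1), hfF v (le_trans (le_min hx hy) hv.1)]
    simp

lemma bdd_Ici {f : ℝ → ℂ} {c : ℝ} {L : ℂ} (hf : ContinuousOn f (Ici c))
    (hL : Tendsto f atTop (nhds L)) : ∃ C, ∀ x, c ≤ x → ‖f x‖ ≤ C := by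
  have h1 : ∀ᶠ x in atTop, ‖f x‖ < ‖L‖ + 1 :=
    hL.norm.eventually_lt_const (by linarith)
  obtain ⟨M, hM⟩ := eventually_atTop.1 h1
  obtain ⟨C, hC⟩ := (isCompact_Icc (a := c) (b := M)).exists_bound_of_continuousOn
    (hf.mono Icc_subset_Ici_self)
  refine ⟨max C (‖L‖ + 1), fun x hx => ?_⟩
  rcases le_total x M with h | h
  · exact (hC x ⟨hx, h⟩).trans (le_max_left _ _)
  · exact (hM x h).le.trans (le_max_right _ _)

lemma mem_slit {z : ℂ} (hz : ∀ t : ℝ, 0 ≤ t → (t : ℂ) ≠ z) {s P : ℝ} (hP : 0 < P)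
    (hs : |s| ≤ ‖z‖ / 2) : ((s : ℂ) - z) / (P : ℂ) ∈ slitPlane := by
  have hz0 : z ≠ 0 := fun h => hz 0 le_rfl (by simp [h])
  rw [mem_slitPlane_iff, div_ofReal_re, div_ofReal_im]
  by_cases him : z.im = 0
  · left
    have hzr : z = (z.re : ℂ) := Complex.ext (by simp) (by simp [him])
    have hneg : z.re < 0 := by
      by_contra hcon
      exact hz z.re (not_lt.1 hcon) hzr.symm
    have hn : ‖z‖ = -z.re := by
      rw [hzr, norm_real, Real.norm_eq_abs, abs_of_neg hneg]; simp
    rw [hn] at hs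
    have := (abs_le.1 hs).1
    apply div_pos _ hP
    simp
    linarith
  · right
    simp [him, hP.ne']

lemma sq_cpow (w : ℂ) : (w ^ (1 / 2 : ℂ)) ^ 2 = w := by
  rw [one_div]; exact cpow_ofNat_inv_pow w 2

lemma re_cpow_pos {w : ℂ} (hw : w ∈ slitPlane) : 0 < (w ^ (1 / 2 : ℂ)).re := by
  rw [one_div, cpow_inv_two_re]
  apply Real.sqrt_pos.2
  have h1 : -‖w‖ ≤ w.re := (abs_le.1 (abs_re_le_norm w)).1
  have h2 : -‖w‖ ≠ w.re := by
    intro h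
    rcases mem_slitPlane_iff.1 hw with h3 | h3
    · have := norm_nonneg w
      linarith
    · have := normSq_eq_norm_sq w
      rw [normSq_apply] at this
      have h4 : w.im * w.im = 0 := by rw [← h] at this; nlinarith
      exact h3 (mul_self_eq_zero.1 h4)
  have := lt_of_le_of_ne h1 h2
  linarith

lemma norm_cpow_le' (w : ℂ) : ‖w ^ (1 / 2 : ℂ)‖ ≤ 1 + ‖w‖ := by
  have h := congrArg norm (sq_cpow w)
  rw [norm_pow] at h
  nlinarith [sq_nonneg (‖w ^ (1 / 2 : ℂ)‖ - 1), norm_nonneg (w ^ (1 / 2 : ℂ))]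

/-- On `[x₁(z),∞)` the function `a(·,z)` is continuously differentiable with
`∂a/∂x = −ω a`, `p·∂a/∂x` is locally absolutely continuous (with a.e. derivative `g`),
the remainder `r = −a⁻¹(p·∂a/∂x)' + q − z` equals `(pω)'` a.e. on `[x₁,∞)`, and `r` is
integrable on `(x₁,∞)`. -/
theorem statement1 (p p' q q' : ℝ → ℝ) (p₀ x₀ : ℝ)
    (hPQ : PQData p p' q q' p₀ x₀)
    (z : ℂ) (hz : ∀ t : ℝ, 0 ≤ t → (t : ℂ) ≠ z)
    (x₁ : ℝ) (hx₁ : x₀ ≤ x₁) (hx₁q : ∀ x : ℝ, x₁ ≤ x → |q x| ≤ ‖z‖ / 2) :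
    ∃ g : ℝ → ℂ,
      (∀ x : ℝ, x₁ ≤ x →
        HasDerivWithinAt (aa p q z) (-omg p q z x * aa p q z x) (Ici x₁) x) ∧
      ContinuousOn (fun x => -omg p q z x * aa p q z x) (Ici x₁) ∧
      (∀ x : ℝ, x₁ ≤ x → ∀ y : ℝ, x₁ ≤ y →
        (p y : ℂ) * (-omg p q z y * aa p q z y) -
            (p x : ℂ) * (-omg p q z x * aa p q z x) = ∫ t in x..y, g t) ∧
      (∀ᵐ x ∂(volume : Measure ℝ), x₁ ≤ x →
        HasDerivAt (fun t => (p t : ℂ) * omg p q z t)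
          (-(aa p q z x)⁻¹ * g x + (q x : ℂ) - z) x) ∧
      IntegrableOn (fun x => -(aa p q z x)⁻¹ * g x + (q x : ℂ) - z) (Ioi x₁) := by
  have hx₀ := hPQ.hx₀
  have hx10 : 0 ≤ x₁ := hx₀.trans hx₁
  obtain ⟨hpc, hpd, hpac⟩ := prim_facts hPQ.p_ac hPQ.p'_int
  obtain ⟨hqc, hqd, hqac⟩ := prim_facts hPQ.q_ac hPQ.q'_int
  set ω : ℝ → ℂ := omg p q z with hω
  have hω_apply : ∀ t, ω t = (((q t : ℂ) - z) / (p t : ℂ)) ^ (1 / 2 : ℂ) := fun t => rfl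
  have hpp : ∀ t, x₁ ≤ t → 0 < p t := fun t ht => hPQ.p_pos t (hx10.trans ht)
  have hslit : ∀ t, x₁ ≤ t → ((q t : ℂ) - z) / (p t : ℂ) ∈ slitPlane :=
    fun t ht => mem_slit hz (hpp t ht) (hx₁q t ht)
  have hωsq : ∀ t, ω t ^ 2 = ((q t : ℂ) - z) / (p t : ℂ) := fun t => sq_cpow _
  have hωre : ∀ t, x₁ ≤ t → 0 < (ω t).re := fun t ht => re_cpow_pos (hslit t ht)
  have hω0 : ∀ t, x₁ ≤ t → ω t ≠ 0 := fun t ht h => by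
    have := hωre t ht
    rw [h] at this
    simp at this
  have hpcC : ContinuousOn (fun t => (p t : ℂ)) (Ici x₁) :=
    continuous_ofReal.comp_continuousOn (hpc.mono (Ici_subset_Ici.2 hx10))
  have hqcC : ContinuousOn (fun t => (q t : ℂ)) (Ici x₁) :=
    continuous_ofReal.comp_continuousOn (hqc.mono (Ici_subset_Ici.2 hx₁))
  have hωc : ContinuousOn ω (Ici x₁) := by
    have h1 : ContinuousOn (fun t => ((q t : ℂ) - z) / (p t : ℂ)) (Ici x₁) :=
      (hqcC.sub continuousOn_const).div hpcC
        fun t ht => ofReal_ne_zero.2 (hpp t ht).ne'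
    exact h1.cpow continuousOn_const fun t ht => hslit t ht
  -- integrability of `ω` near zero
  have hωint : IntervalIntegrable ω volume 0 x₁ := by
    rw [intervalIntegrable_iff, uIoc_of_le hx10]
    have hq1 : IntegrableOn q (Icc 0 x₁) := by
      have h2 : IntegrableOn q (Icc x₀ x₁) :=
        (hqc.mono Icc_subset_Ici_self).integrableOn_Icc
      have h1 : IntegrableOn q (Icc 0 x₀) := by
        rw [integrableOn_Icc_iff_integrableOn_Ioo]; exact hPQ.q_int
      rw [← Icc_union_Icc_eq_Icc hx₀ hx₁]
      exact h1.union h2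
    have hq2 : IntegrableOn (fun t => (q t : ℂ) - z) (Icc 0 x₁) :=
      (Integrable.ofReal hq1).sub (continuous_const.continuousOn.integrableOn_Icc)
    have hpi : ContinuousOn (fun t => ((p t : ℂ))⁻¹) (Icc 0 x₁) :=
      (continuous_ofReal.comp_continuousOn (hpc.mono Icc_subset_Ici_self)).inv₀
        fun t ht => ofReal_ne_zero.2 (hPQ.p_pos t ht.1).ne'
    have hw : IntegrableOn (fun t => ((q t : ℂ) - z) / (p t : ℂ)) (Icc 0 x₁) := by
      simp only [div_eq_mul_inv]
      exact hq2.mul_continuousOn hpi isCompact_Icc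
    have hb : IntegrableOn (fun t => 1 + ‖((q t : ℂ) - z) / (p t : ℂ)‖) (Icc 0 x₁) :=
      (continuous_const.continuousOn.integrableOn_Icc).add hw.norm
    have hres : IntegrableOn ω (Icc 0 x₁) := by
      refine Integrable.mono' hb ?_ (Eventually.of_forall fun t => norm_cpow_le' _)
      have hm : Measurable fun w : ℂ => w ^ (1 / 2 : ℂ) := measurable_id.pow_const _
      exact (hm.comp_aemeasurable hw.aestronglyMeasurable.aemeasurable).aestronglyMeasurable
    exact hres.mono_set Ioc_subset_Icc_self
  -- `Ω` is differentiable
  have hΩd : ∀ x, x₁ ≤ x → HasDerivWithinAt (Omg p q z) (ω x) (Ici x₁) x := by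
    intro x hx
    have hc : Continuous fun t => ω (max t x₁) :=
      hωc.comp_continuous (continuous_id.max continuous_const) fun t => mem_Ici.2 (le_max_right _ _)
    have h1 : HasDerivAt (fun t => Omg p q z x₁ + ∫ s in x₁..t, ω (max s x₁))
        (ω (max x x₁)) x :=
      (hc.integral_hasStrictDerivAt x₁ x).hasDerivAt.const_add _
    rw [max_eq_left hx] at h1
    have heq : ∀ t ∈ Ici x₁, Omg p q z t = Omg p q z x₁ + ∫ s in x₁..t, ω (max s x₁) := by
      intro t ht
      have h2 : ∫ s in x₁..t, ω (max s x₁) = ∫ s in x₁..t, ω s := by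
        apply intervalIntegral.integral_congr
        intro s hs
        rw [uIcc_of_le ht] at hs
        simp only [max_eq_left hs.1]
      rw [h2]
      unfold Omg
      refine (intervalIntegral.integral_add_adjacent_intervals hωint ?_).symm
      apply ContinuousOn.intervalIntegrable
      rw [uIcc_of_le ht]
      exact hωc.mono Icc_subset_Ici_self
    exact h1.hasDerivWithinAt.congr heq (heq x hx)
  have had : ∀ x, x₁ ≤ x →
      HasDerivWithinAt (aa p q z) (-ω x * aa p q z x) (Ici x₁) x := by
    intro x hx
    have h := (hΩd x hx).neg.cexp
    have e : -ω x * aa p q z x = cexp (-Omg p q z x) * -ω x := by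
      unfold aa; ring
    rw [e]
    exact h
  set a : ℝ → ℂ := aa p q z with ha
  have ha0 : ∀ x, a x ≠ 0 := fun x => exp_ne_zero _
  have hac : ContinuousOn a (Ici x₁) := fun x hx => (had x hx).continuousWithinAt
  have hωac : ContinuousOn (fun x => -ω x * a x) (Ici x₁) := hωc.neg.mul hac
  set r : ℝ → ℂ := fun t => ω t / 2 * (p' t : ℂ) + (ω t)⁻¹ / 2 * (q' t : ℂ) with hr
  -- the derivative of `p ω`
  have hFd : ∀ᵐ x ∂(volume : Measure ℝ), x₁ ≤ x →
      HasDerivAt (fun t => (p t : ℂ) * ω t) (r x) x := by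
    have hne : ∀ᵐ x ∂(volume : Measure ℝ), x ≠ x₁ := by simp [ae_iff, measure_singleton]
    filter_upwards [hpd, hqd, hne] with x h1 h2 h3 h4
    have hlt : x₁ < x := lt_of_le_of_ne h4 h3.symm
    have dp := (h1 (hx10.trans_lt hlt)).ofReal_comp
    have dq := (h2 (hx₁.trans_lt hlt)).ofReal_comp
    have hp0 : (p x : ℂ) ≠ 0 := ofReal_ne_zero.2 (hpp x h4).ne'
    have dw := (dq.sub_const z).div dp hp0
    have dω : HasDerivAt ω ((1 / 2 : ℂ) * (((q x : ℂ) - z) / (p x : ℂ)) ^ ((1 / 2 : ℂ) - 1) *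
        (((q' x : ℂ) * (p x : ℂ) - ((q x : ℂ) - z) * (p' x : ℂ)) / (p x : ℂ) ^ 2)) x :=
      HasDerivAt.comp x (h₂ := fun w : ℂ => w ^ (1 / 2 : ℂ))
        (Complex.hasStrictDerivAt_cpow_const (hslit x h4)).hasDerivAt dw
    have hd := dp.mul dω
    refine hd.congr_deriv ?_
    have hw0 : ((q x : ℂ) - z) / (p x : ℂ) ≠ 0 := slitPlane_ne_zero (hslit x h4)
    have e1 : (((q x : ℂ) - z) / (p x : ℂ)) ^ ((1 / 2 : ℂ) - 1) = (ω x)⁻¹ := by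
      rw [cpow_sub _ _ hw0, cpow_one, ← hω_apply, ← hωsq]
      have := hω0 x h4
      field_simp
    have e2 : (q x : ℂ) - z = ω x ^ 2 * p x := by
      rw [hωsq]; field_simp
    simp only [hr]
    rw [e1, e2]
    have := hω0 x h4
    field_simp
    ring
  -- integrability of `r`
  have hωlim : Tendsto ω atTop (nhds (((((0 : ℝ) : ℂ) - z) / (p₀ : ℂ)) ^ (1 / 2 : ℂ))) := by
    have hs : (((0 : ℝ) : ℂ) - z) / (p₀ : ℂ) ∈ slitPlane :=
      mem_slit hz hPQ.hp₀ (by rw [abs_zero]; positivity)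
    have h1 : Tendsto (fun t => ((q t : ℂ) - z) / (p t : ℂ)) atTop
        (nhds ((((0 : ℝ) : ℂ) - z) / (p₀ : ℂ))) :=
      (((continuous_ofReal.tendsto _).comp hPQ.q_lim).sub_const z).div
        ((continuous_ofReal.tendsto _).comp hPQ.p_lim) (ofReal_ne_zero.2 hPQ.hp₀.ne')
    exact h1.cpow tendsto_const_nhds hs
  have hL0 : ((((0 : ℝ) : ℂ) - z) / (p₀ : ℂ)) ^ (1 / 2 : ℂ) ≠ 0 := by
    intro h
    have := re_cpow_pos (mem_slit hz hPQ.hp₀ (s := 0) (by rw [abs_zero]; positivity))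
    rw [h] at this
    simp at this
  have hωic : ContinuousOn (fun t => (ω t)⁻¹) (Ici x₁) := hωc.inv₀ hω0
  obtain ⟨C1, hC1⟩ := bdd_Ici hωc hωlim
  obtain ⟨C2, hC2⟩ := bdd_Ici hωic (hωlim.inv₀ hL0)
  have hrint : IntegrableOn r (Ioi x₁) := by
    have ip : IntegrableOn (fun t => (p' t : ℂ)) (Ioi x₁) :=
      Integrable.ofReal (hPQ.p'_int.mono_set (Ioi_subset_Ioi hx10))
    have iq : IntegrableOn (fun t => (q' t : ℂ)) (Ioi x₁) :=
      Integrable.ofReal (hPQ.q'_int.mono_set (Ioi_subset_Ioi hx₁))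
    have m1 : AEStronglyMeasurable (fun t => ω t / 2) (volume.restrict (Ioi x₁)) :=
      ((hωc.div_const 2).mono Ioi_subset_Ici_self).aestronglyMeasurable measurableSet_Ioi
    have m2 : AEStronglyMeasurable (fun t => (ω t)⁻¹ / 2) (volume.restrict (Ioi x₁)) :=
      ((hωic.div_const 2).mono Ioi_subset_Ici_self).aestronglyMeasurable measurableSet_Ioi
    refine Integrable.add (Integrable.bdd_mul (c := C1 / 2) ip m1 ?_)
      (Integrable.bdd_mul (c := C2 / 2) iq m2 ?_)
    · filter_upwards [ae_restrict_mem measurableSet_Ioi] with t ht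
      have := hC1 t (le_of_lt ht)
      rw [norm_div]
      simp
      linarith
    · filter_upwards [ae_restrict_mem measurableSet_Ioi] with t ht
      have := hC2 t (le_of_lt ht)
      rw [norm_div]
      simp only [norm_ofNat]
      linarith
  have hrg : ∀ x, -(a x)⁻¹ * (a x * ((q x : ℂ) - z - r x)) + (q x : ℂ) - z = r x := by
    intro x
    have := ha0 x
    field_simp
    ring
  refine ⟨fun t => a t * ((q t : ℂ) - z - r t), had, hωac, ?_, ?_, ?_⟩
  · intro x hx y hy
    have hsub : uIcc x y ⊆ Ici x₁ := fun t ht => (le_min hx hy).trans ht.1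
    have acp : AbsolutelyContinuousOnInterval (fun t => (p t : ℂ)) x y := by
      refine ac_of_dist_le (K := 1) (hpac x (hx10.trans hx) y (hx10.trans hy)) ?_
      intro u _ v _
      rw [dist_of_im_eq (by simp)]
      simp
    have acq : AbsolutelyContinuousOnInterval (fun t => (q t : ℂ) - z) x y := by
      refine ac_of_dist_le (K := 1) (hqac x (hx₁.trans hx) y (hx₁.trans hy)) ?_
      intro u _ v _
      rw [dist_sub_right, dist_of_im_eq (by simp)]
      simp
    have acW := acp.smul acq
    have hFc : ContinuousOn (fun t => (p t : ℂ) * ω t) (uIcc x y) :=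
      (hpcC.mul hωc).mono hsub
    have hFre : ∀ t ∈ uIcc x y, 0 < ((p t : ℂ) * ω t).re := by
      intro t ht
      rw [re_ofReal_mul]
      exact mul_pos (hpp t (hsub ht)) (hωre t (hsub ht))
    obtain ⟨m, hm, hmin⟩ := (isCompact_uIcc (a := x) (b := y)).exists_isMinOn
      nonempty_uIcc (continuous_re.comp_continuousOn hFc)
    have acF : AbsolutelyContinuousOnInterval (fun t => (p t : ℂ) * ω t) x y := by
      set δ := ((p m : ℂ) * ω m).re with hδ
      have hδ0 : 0 < δ := hFre m hm
      refine ac_of_dist_le (K := δ⁻¹) acW ?_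
      intro u hu v hv
      have hsq : ∀ t ∈ uIcc x y, (p t : ℂ) * ((q t : ℂ) - z) = ((p t : ℂ) * ω t) ^ 2 := by
        intro t ht
        have hp0 : (p t : ℂ) ≠ 0 := ofReal_ne_zero.2 (hpp t (hsub ht)).ne'
        rw [mul_pow, hωsq]
        field_simp
      simp only [Pi.smul_apply', smul_eq_mul]
      rw [hsq u hu, hsq v hv, dist_eq_norm, dist_eq_norm, sq_sub_sq, norm_mul]
      have h1 : δ ≤ ‖(p u : ℂ) * ω u + (p v : ℂ) * ω v‖ := by
        refine le_trans ?_ (re_le_norm _)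
        rw [add_re]
        have h2 : δ ≤ ((p u : ℂ) * ω u).re := hmin hu
        have h3 := hFre v hv
        linarith
      rw [← mul_assoc]
      refine le_mul_of_one_le_left (norm_nonneg _) ?_
      rw [inv_mul_eq_div, one_le_div hδ0]
      exact h1
    have aca : AbsolutelyContinuousOnInterval a x y := by
      obtain ⟨C, hC⟩ := (isCompact_uIcc (a := x) (b := y)).exists_bound_of_continuousOn
        (hωac.mono hsub)
      have hid : AbsolutelyContinuousOnInterval (fun t : ℝ => t) x y :=
        (LipschitzWith.id.lipschitzOnWith).absolutelyContinuousOnInterval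
      refine ac_of_dist_le (K := C) hid ?_
      intro u hu v hv
      rw [dist_eq_norm, dist_eq_norm]
      exact Convex.norm_image_sub_le_of_norm_hasDerivWithin_le
        (fun t ht => (had t (hsub ht)).mono hsub) hC (convex_uIcc x y) hv hu
    have acH := (acF.smul aca).neg
    have hft := ftc_complex (g := fun t => a t * ((q t : ℂ) - z - r t)) acH ?_ ?_
    · rw [← hft]
      simp only [Pi.neg_apply, smul_eq_mul, Pi.mul_apply]
      ring
    · have hne : ∀ᵐ x ∂(volume : Measure ℝ), x ≠ x₁ := by simp [ae_iff, measure_singleton]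
      filter_upwards [hFd, hne] with t h1 h2 h3
      have ht : x₁ ≤ t := hsub (uIoc_subset_uIcc h3)
      have hlt : x₁ < t := lt_of_le_of_ne ht h2.symm
      have da : HasDerivAt a (-ω t * a t) t := (had t ht).hasDerivAt (Ici_mem_nhds hlt)
      have hd := ((h1 ht).mul da).neg
      refine hd.congr_deriv ?_
      have hp0 : (p t : ℂ) ≠ 0 := ofReal_ne_zero.2 (hpp t ht).ne'
      have e2 : (q t : ℂ) - z = ω t ^ 2 * p t := by
        rw [hωsq]; field_simp
      rw [e2]
      ring
    · have i1 : IntervalIntegrable (fun t => (q t : ℂ) - z - r t) volume x y := by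
        refine IntervalIntegrable.sub ?_ ?_
        · exact ((hqcC.sub continuousOn_const).mono hsub).intervalIntegrable
        · rw [intervalIntegrable_iff]
          exact hrint.mono_set fun t ht => lt_of_le_of_lt (le_min hx hy) ht.1
      exact i1.continuousOn_mul (hac.mono hsub)
  · filter_upwards [hFd] with x hx h
    rw [hrg]
    exact hx h
  · exact hrint.congr_fun (fun x _ => (hrg x).symm) measurableSet_Ioi

end
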